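/- Let N ≥ 1, p > 1, and let ω₁, ω₂ : ℝ^N → ℝ be smooth positive functions with ∇ω₁(x) · x ≥ 0 for all x with |x| sufficiently large. Suppose there exists t with p − √(p(p−1)) < t ≤ 1 such that I_L(R) → 0 as R → ∞, where I_L(R) = R^{-2(2t+p−1)/(p−1)} ∫_{R<|x|<2R} (ω₁^{p+2t−1}/ω₂^{2t})^{1/(p−1)} dx. Then there is no positive stable sub-solution of the equation −div(ω₁ ∇u) = ω₂ u^p in ℝ^N. -/

import Mathlib

open MeasureTheory Filter Real
open scoped RealInnerProductSpace

noncomputable def vdiv {N : ℕ} (V : EuclideanSpace ℝ (Fin N) → EuclideanSpace ℝ (Fin N))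
    (x : EuclideanSpace ℝ (Fin N)) : ℝ :=
  LinearMap.trace ℝ (EuclideanSpace ℝ (Fin N)) (fderiv ℝ V x).toLinearMap

def annulus (N : ℕ) (R : ℝ) : Set (EuclideanSpace ℝ (Fin N)) :=
  {x | R < ‖x‖ ∧ ‖x‖ < 2 * R}

section Calculus

variable {E : Type*} [NormedAddCommGroup E] [InnerProductSpace ℝ E] [CompleteSpace E]

theorem norm_gradient_eq_norm_fderiv (f : E → ℝ) (x : E) : ‖gradient f x‖ = ‖fderiv ℝ f x‖ := by
  simp [gradient]

theorem ContDiff.gradient_succ {f : E → ℝ} {n : WithTop ℕ∞} (hf : ContDiff ℝ (n + 1) f) :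
    ContDiff ℝ n (gradient f) :=
  (InnerProductSpace.toDual ℝ E).symm.contDiff.comp (hf.fderiv_right le_rfl)

theorem HasGradientAt.mul {f g : E → ℝ} {f' g' x : E} (hf : HasGradientAt f f' x)
    (hg : HasGradientAt g g' x) :
    HasGradientAt (fun y => f y * g y) (f x • g' + g x • f') x := by
  refine hasGradientAt_iff_hasFDerivAt.2 (HasFDerivAt.congr_fderiv
    ((hasGradientAt_iff_hasFDerivAt.1 hf).mul (hasGradientAt_iff_hasFDerivAt.1 hg)) ?_)
  ext v
  simp

theorem HasGradientAt.rpow_const {f : E → ℝ} {f' x : E} (hf : HasGradientAt f f' x) (r : ℝ)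
    (h : f x ≠ 0) : HasGradientAt (fun y => f y ^ r) ((r * f x ^ (r - 1)) • f') x := by
  refine hasGradientAt_iff_hasFDerivAt.2 (HasFDerivAt.congr_fderiv
    ((hasGradientAt_iff_hasFDerivAt.1 hf).rpow_const (Or.inl h)) ?_)
  ext v
  simp

theorem HasGradientAt.pow {f : E → ℝ} {f' x : E} (hf : HasGradientAt f f' x) (n : ℕ) :
    HasGradientAt (fun y => f y ^ n) ((n * f x ^ (n - 1)) • f') x := by
  refine hasGradientAt_iff_hasFDerivAt.2 (HasFDerivAt.congr_fderiv
    (HasFDerivAt.pow (hasGradientAt_iff_hasFDerivAt.1 hf) n) ?_)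
  ext v
  simp

end Calculus

section Divergence

variable {N : ℕ}

theorem vdiv_smul {G : EuclideanSpace ℝ (Fin N) → ℝ}
    {W : EuclideanSpace ℝ (Fin N) → EuclideanSpace ℝ (Fin N)} {x : EuclideanSpace ℝ (Fin N)}
    (hG : DifferentiableAt ℝ G x) (hW : DifferentiableAt ℝ W x) :
    vdiv (fun y => G y • W y) x = G x * vdiv W x + ⟪gradient G x, W x⟫ := by
  unfold vdiv
  rw [fderiv_fun_smul hG hW, inner_gradient_left]
  have h := LinearMap.trace_smulRight (fderiv ℝ G x).toLinearMap (W x)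
  rw [ContinuousLinearMap.toLinearMap_add, map_add, ContinuousLinearMap.toLinearMap_smul, map_smul,
    smul_eq_mul]
  congr 1

theorem integral_fderiv_apply_eq_zero {f : EuclideanSpace ℝ (Fin N) → ℝ} (hf : ContDiff ℝ 1 f)
    (hc : HasCompactSupport f) (v : EuclideanSpace ℝ (Fin N)) : ∫ x, fderiv ℝ f x v = 0 := by
  have h := integral_mul_fderiv_eq_neg_fderiv_mul_of_integrable (𝕜 := ℝ) (μ := volume)
    (f := fun _ : EuclideanSpace ℝ (Fin N) => (1 : ℝ)) (g := f) (v := v) (by simp)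
    (by
      simp only [one_mul]
      exact ((hf.continuous_fderiv one_ne_zero).clm_apply
        continuous_const).integrable_of_hasCompactSupport (hc.fderiv_apply ℝ v))
    (by simpa using hf.continuous.integrable_of_hasCompactSupport hc)
    (fun _ _ => differentiableAt_const _)
    (fun x _ => hf.differentiable one_ne_zero x)
  simpa using h

theorem vdiv_eq_sum {V : EuclideanSpace ℝ (Fin N) → EuclideanSpace ℝ (Fin N)}
    {x : EuclideanSpace ℝ (Fin N)} (hV : DifferentiableAt ℝ V x) :
    vdiv V x = ∑ i, fderiv ℝ (fun y => V y i) x (EuclideanSpace.single i 1) := by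
  unfold vdiv
  rw [LinearMap.trace_eq_sum_inner _ (EuclideanSpace.basisFun (Fin N) ℝ)]
  refine Finset.sum_congr rfl fun i _ => ?_
  have h : HasFDerivAt (fun y => V y i)
      ((EuclideanSpace.proj i : EuclideanSpace ℝ (Fin N) →L[ℝ] ℝ).comp (fderiv ℝ V x)) x :=
    (EuclideanSpace.proj i : EuclideanSpace ℝ (Fin N) →L[ℝ] ℝ).hasFDerivAt.comp x hV.hasFDerivAt
  rw [h.fderiv]
  simp [EuclideanSpace.inner_single_left]

theorem HasCompactSupport.integral_vdiv_eq_zero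
    {V : EuclideanSpace ℝ (Fin N) → EuclideanSpace ℝ (Fin N)} (hc : HasCompactSupport V)
    (hV : ContDiff ℝ 1 V) : ∫ x, vdiv V x = 0 := by
  have hi : ∀ i, ContDiff ℝ 1 fun y => V y i := fun i =>
    (EuclideanSpace.proj i : EuclideanSpace ℝ (Fin N) →L[ℝ] ℝ).contDiff.comp hV
  have hci : ∀ i, HasCompactSupport fun y => V y i := fun i =>
    hc.comp_left (g := fun v : EuclideanSpace ℝ (Fin N) => v i) rfl
  simp_rw [fun x => vdiv_eq_sum (hV.differentiable one_ne_zero x)]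
  rw [integral_finsetSum]
  · exact Finset.sum_eq_zero fun i _ => integral_fderiv_apply_eq_zero (hi i) (hci i) _
  · exact fun i _ => (((hi i).continuous_fderiv one_ne_zero).clm_apply
      continuous_const).integrable_of_hasCompactSupport ((hci i).fderiv_apply ℝ _)

theorem continuous_vdiv {V : EuclideanSpace ℝ (Fin N) → EuclideanSpace ℝ (Fin N)}
    (hV : ContDiff ℝ 1 V) : Continuous (vdiv V) := by
  simp_rw [funext fun x => vdiv_eq_sum (hV.differentiable one_ne_zero x)]
  refine continuous_finsetSum _ fun i _ => Continuous.clm_apply ?_ continuous_const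
  exact ((EuclideanSpace.proj i : EuclideanSpace ℝ (Fin N) →L[ℝ] ℝ).contDiff.comp
    hV).continuous_fderiv one_ne_zero

theorem HasCompactSupport.vdiv {V : EuclideanSpace ℝ (Fin N) → EuclideanSpace ℝ (Fin N)}
    (hc : HasCompactSupport V) : HasCompactSupport (vdiv V) :=
  (hc.fderiv ℝ).comp_left (g := fun L : EuclideanSpace ℝ (Fin N) →L[ℝ] EuclideanSpace ℝ (Fin N) =>
    LinearMap.trace ℝ _ L.toLinearMap) (by simp)

end Divergence

theorem exists_cutoff (E : Type*) [NormedAddCommGroup E] [InnerProductSpace ℝ E]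
    [FiniteDimensional ℝ E] :
    ∃ C : ℝ, 0 < C ∧ ∀ R : ℝ, 0 < R → ∃ η : E → ℝ, ContDiff ℝ 2 η ∧ HasCompactSupport η ∧
      (∀ x, 0 ≤ η x) ∧ (∀ x, η x ≤ 1) ∧ (∀ x, ‖x‖ ≤ R → η x = 1) ∧
      (∀ x, ‖gradient η x‖ ≤ C / R) ∧
      (∀ x, ¬ (R < ‖x‖ ∧ ‖x‖ < 2 * R) → gradient η x = 0) := by
  let g : E → ℝ := fun y => smoothTransition ((4 - ‖y‖ ^ 2) / 3)
  have hg : ContDiff ℝ 2 g := by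
    have h : ContDiff ℝ 2 fun y : E => (4 - ‖y‖ ^ 2) / 3 :=
      (contDiff_const.sub (contDiff_norm_sq ℝ)).div_const 3
    exact (smoothTransition.contDiff (n := 2)).comp h
  have hg0 : ∀ y, 2 ≤ ‖y‖ → g y = 0 := fun y hy =>
    smoothTransition.zero_of_nonpos (by nlinarith)
  have hg1 : ∀ y, ‖y‖ ≤ 1 → g y = 1 := fun y hy =>
    smoothTransition.one_of_one_le (by nlinarith [norm_nonneg y])
  have hgc : HasCompactSupport g := by
    refine HasCompactSupport.intro (isCompact_closedBall (0 : E) 2) fun y hy => hg0 y ?_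
    simp only [Metric.mem_closedBall, dist_zero_right, not_le] at hy
    exact hy.le
  obtain ⟨C, hC⟩ := (hgc.fderiv ℝ).exists_bound_of_continuous (hg.continuous_fderiv two_ne_zero)
  refine ⟨max C 1, by positivity, fun R hR => ?_⟩
  have hnorm : ∀ x : E, ‖R⁻¹ • x‖ = ‖x‖ / R := fun x => by
    rw [norm_smul, norm_inv, Real.norm_of_nonneg hR.le]; field_simp
  have h0 : ∀ x, 0 ≤ g (R⁻¹ • x) := fun x => smoothTransition.nonneg _
  have h1 : ∀ x, g (R⁻¹ • x) ≤ 1 := fun x => smoothTransition.le_one _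
  have hone : ∀ x, ‖x‖ ≤ R → g (R⁻¹ • x) = 1 := fun x hx =>
    hg1 _ (by rw [hnorm]; exact div_le_one_of_le₀ hx hR.le)
  have hzero : ∀ x, 2 * R ≤ ‖x‖ → g (R⁻¹ • x) = 0 := fun x hx =>
    hg0 _ (by rw [hnorm, le_div_iff₀ hR]; exact hx)
  refine ⟨fun x => g (R⁻¹ • x), hg.comp (contDiff_const_smul _),
    hgc.comp_smul (inv_ne_zero hR.ne'), h0, h1, hone, fun x => ?_, fun x hx => ?_⟩
  · rw [norm_gradient_eq_norm_fderiv, fderiv_comp_smul, norm_smul, norm_inv,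
      Real.norm_of_nonneg hR.le, div_eq_inv_mul]
    gcongr
    exact (hC _).trans (le_max_left _ _)
  · rw [← norm_eq_zero, norm_gradient_eq_norm_fderiv, norm_eq_zero]
    by_cases hxR : ‖x‖ ≤ R
    · exact IsLocalMax.fderiv_eq_zero (Eventually.of_forall fun y => by
        simpa [hone x hxR] using h1 y)
    · have : 2 * R ≤ ‖x‖ := by
        by_contra! h
        exact hx ⟨not_le.mp hxR, h⟩
      exact IsLocalMin.fderiv_eq_zero (Eventually.of_forall fun y => by
        simpa [hzero x this] using h0 y)

section StableSubsolution

variable {N : ℕ} {p : ℝ} {ω₁ ω₂ u : EuclideanSpace ℝ (Fin N) → ℝ}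

theorem integral_subsolution_test {φ : EuclideanSpace ℝ (Fin N) → ℝ}
    (hω₁ : ContDiff ℝ 1 ω₁) (hω₂ : Continuous ω₂)
    (hu : ContDiff ℝ 2 u) (hupos : ∀ x, 0 < u x)
    (hsub : ∀ x, -vdiv (fun y => ω₁ y • gradient u y) x ≤ ω₂ x * u x ^ p) (t : ℝ)
    (hφ : ContDiff ℝ 2 φ) (hφc : HasCompactSupport φ) :
    ∫ x, ((2 * t - 1) * (ω₁ x * ‖(u x ^ (t - 1) * φ x) • gradient u x‖ ^ 2) +
        2 * (ω₁ x * ⟪(u x ^ (t - 1) * φ x) • gradient u x, u x ^ t • gradient φ x⟫)) ≤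
      ∫ x, ω₂ x * u x ^ (2 * t + p - 1) * φ x ^ 2 := by
  have hgu : ContDiff ℝ 1 (gradient u) := ContDiff.gradient_succ hu
  have hgφ : ContDiff ℝ 1 (gradient φ) := ContDiff.gradient_succ hφ
  have hup : ∀ r : ℝ, ContDiff ℝ 2 fun x => u x ^ r := fun r =>
    hu.rpow_const_of_ne fun x => (hupos x).ne'
  have hupc : ∀ r : ℝ, Continuous fun x => u x ^ r := fun r => (hup r).continuous
  have hgrad : ∀ x, HasGradientAt (fun y => u y ^ (2 * t - 1) * φ y ^ 2) (u x ^ (2 * t - 1) •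
      ((2 : ℕ) * φ x ^ (2 - 1)) • gradient φ x +
      φ x ^ 2 • ((2 * t - 1) * u x ^ (2 * t - 1 - 1)) • gradient u x) x := fun x =>
    ((hu.differentiable two_ne_zero x).hasGradientAt.rpow_const _ (hupos x).ne').mul
      ((hφ.differentiable two_ne_zero x).hasGradientAt.pow 2)
  have hG : ContDiff ℝ 1 fun y => u y ^ (2 * t - 1) * φ y ^ 2 :=
    ((hup _).mul (hφ.pow 2)).of_le one_le_two
  have hW : ContDiff ℝ 1 fun y => ω₁ y • gradient u y := hω₁.smul hgu
  set V := fun y => (u y ^ (2 * t - 1) * φ y ^ 2) • (ω₁ y • gradient u y) with hV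
  have hVc : HasCompactSupport V := by
    refine hφc.mono fun x hx (h0 : φ x = 0) => hx (by simp [h0, hV])
  have hV1 : ContDiff ℝ 1 V := hG.smul hW
  have hdiv : ∀ x, vdiv V x = u x ^ (2 * t - 1) * φ x ^ 2 * vdiv (fun y => ω₁ y • gradient u y) x +
      ((2 * t - 1) * (ω₁ x * ‖(u x ^ (t - 1) * φ x) • gradient u x‖ ^ 2) +
        2 * (ω₁ x * ⟪(u x ^ (t - 1) * φ x) • gradient u x, u x ^ t • gradient φ x⟫)) := by
    intro x
    rw [hV, vdiv_smul (hG.differentiable one_ne_zero x) (hW.differentiable one_ne_zero x),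
      (hgrad x).gradient]
    have e1 : u x ^ (2 * t - 1) = u x ^ (t - 1) * u x ^ t := by
      rw [← rpow_add (hupos x)]; ring_nf
    have e2 : u x ^ (2 * t - 1 - 1) = u x ^ (t - 1) * u x ^ (t - 1) := by
      rw [← rpow_add (hupos x)]; ring_nf
    rw [e1, e2, ← real_inner_self_eq_norm_sq]
    simp only [inner_add_left, real_inner_smul_left, real_inner_smul_right,
      real_inner_comm (gradient u x) (gradient φ x)]
    push_cast
    ring
  have hb : Integrable fun x => ω₂ x * u x ^ (2 * t + p - 1) * φ x ^ 2 := by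
    refine Continuous.integrable_of_hasCompactSupport
      ((hω₂.mul (hupc _)).mul (hφ.continuous.pow 2))
      (hφc.mono fun x hx (h0 : φ x = 0) => hx (by simp [h0]))
  have hdV : Integrable (vdiv V) := (continuous_vdiv hV1).integrable_of_hasCompactSupport hVc.vdiv
  have h0 : ∫ x, (ω₂ x * u x ^ (2 * t + p - 1) * φ x ^ 2 + vdiv V x) =
      ∫ x, ω₂ x * u x ^ (2 * t + p - 1) * φ x ^ 2 := by
    rw [integral_add hb hdV, hVc.integral_vdiv_eq_zero hV1, add_zero]
  rw [← h0]
  refine integral_mono ?_ (hb.add hdV) fun x => ?_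
  · have hA : Continuous fun x => (u x ^ (t - 1) * φ x) • gradient u x :=
      ((hupc _).mul hφ.continuous).smul hgu.continuous
    have hD : Continuous fun x => u x ^ t • gradient φ x := (hupc _).smul hgφ.continuous
    refine Continuous.integrable_of_hasCompactSupport
      ((continuous_const.mul (hω₁.continuous.mul (hA.norm.pow 2))).add
        (continuous_const.mul (hω₁.continuous.mul (hA.inner hD))))
      (hφc.mono fun x hx (h0 : φ x = 0) => hx (by simp [h0]))
  · simp only
    rw [hdiv]
    have e : u x ^ (2 * t + p - 1) = u x ^ (2 * t - 1) * u x ^ p := by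
      rw [← rpow_add (hupos x)]; ring_nf
    have h1 : 0 ≤ u x ^ (2 * t - 1) * φ x ^ 2 :=
      mul_nonneg (rpow_nonneg (hupos x).le _) (sq_nonneg _)
    have h2 := mul_le_mul_of_nonneg_left (hsub x) h1
    rw [e]
    linarith

theorem integral_stability_test {φ : EuclideanSpace ℝ (Fin N) → ℝ}
    (hu : ContDiff ℝ 2 u) (hupos : ∀ x, 0 < u x)
    (hstab : ∀ ψ : EuclideanSpace ℝ (Fin N) → ℝ, ContDiff ℝ 2 ψ → HasCompactSupport ψ →
      ∫ x, p * ω₂ x * u x ^ (p - 1) * ψ x ^ 2 ≤ ∫ x, ω₁ x * ‖gradient ψ x‖ ^ 2) (t : ℝ)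
    (hφ : ContDiff ℝ 2 φ) (hφc : HasCompactSupport φ) :
    p * ∫ x, ω₂ x * u x ^ (2 * t + p - 1) * φ x ^ 2 ≤
      ∫ x, (t ^ 2 * (ω₁ x * ‖(u x ^ (t - 1) * φ x) • gradient u x‖ ^ 2) +
        2 * t * (ω₁ x * ⟪(u x ^ (t - 1) * φ x) • gradient u x, u x ^ t • gradient φ x⟫) +
        ω₁ x * ‖u x ^ t • gradient φ x‖ ^ 2) := by
  have h := hstab (fun x => u x ^ t * φ x)
    ((hu.rpow_const_of_ne fun x => (hupos x).ne').mul hφ) hφc.mul_left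
  convert h using 1
  · rw [← integral_const_mul]
    congr 1 with x
    have e : u x ^ (2 * t + p - 1) = u x ^ (p - 1) * (u x ^ t * u x ^ t) := by
      rw [← rpow_add (hupos x), ← rpow_add (hupos x)]; ring_nf
    rw [e]
    ring
  · congr 1 with x
    rw [(((hu.differentiable two_ne_zero x).hasGradientAt.rpow_const t (hupos x).ne').mul
      (hφ.differentiable two_ne_zero x).hasGradientAt).gradient, smul_smul,
      show φ x * (t * u x ^ (t - 1)) = t * (u x ^ (t - 1) * φ x) by ring, mul_smul t,
      norm_add_sq_real, real_inner_smul_right _ _ t, norm_smul t, mul_pow, Real.norm_eq_abs, sq_abs,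
      real_inner_comm _ (u x ^ t • gradient φ x)]
    ring

/-- Caccioppoli-type estimate: the `u`-weighted energy is controlled by the gradient of the
test function. -/
theorem exists_caccioppoli_const (hω₁ : ContDiff ℝ 1 ω₁) (hω₂ : Continuous ω₂)
    (hω₁pos : ∀ x, 0 < ω₁ x) (hu : ContDiff ℝ 2 u) (hupos : ∀ x, 0 < u x)
    (hsub : ∀ x, -vdiv (fun y => ω₁ y • gradient u y) x ≤ ω₂ x * u x ^ p)
    (hstab : ∀ ψ : EuclideanSpace ℝ (Fin N) → ℝ, ContDiff ℝ 2 ψ → HasCompactSupport ψ →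
      ∫ x, p * ω₂ x * u x ^ (p - 1) * ψ x ^ 2 ≤ ∫ x, ω₁ x * ‖gradient ψ x‖ ^ 2)
    {t : ℝ} (ht : 1 < 2 * t) (hpt : t ^ 2 < p * (2 * t - 1)) :
    ∃ K : ℝ, 0 < K ∧ ∀ φ : EuclideanSpace ℝ (Fin N) → ℝ, ContDiff ℝ 2 φ → HasCompactSupport φ →
      ∫ x, ω₂ x * u x ^ (2 * t + p - 1) * φ x ^ 2 ≤
        K * ∫ x, ω₁ x * ‖u x ^ t • gradient φ x‖ ^ 2 := by
  set κ := (p * (2 * t - 1) - t ^ 2) / 2 with hκ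
  have hκ0 : 0 < κ := by rw [hκ]; linarith
  set σ := 2 * t - 1 with hσ
  have hσ0 : 0 < σ := by rw [hσ]; linarith
  set k := 2 * t * σ - 2 * (t ^ 2 + κ) with hk
  set M := σ + k ^ 2 / (4 * (σ * κ)) with hM
  have hM0 : 0 < M := by positivity
  refine ⟨M / κ, by positivity, fun φ hφ hφc => ?_⟩
  have h1 := integral_subsolution_test hω₁ hω₂ hu hupos hsub t hφ hφc
  have h2 := integral_stability_test hu hupos hstab t hφ hφc
  have hgu : ContDiff ℝ 1 (gradient u) := ContDiff.gradient_succ hu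
  have hgφ : ContDiff ℝ 1 (gradient φ) := ContDiff.gradient_succ hφ
  have hup : ∀ r : ℝ, Continuous fun x => u x ^ r := fun r =>
    hu.continuous.rpow_const fun x => Or.inl (hupos x).ne'
  set A := fun x => (u x ^ (t - 1) * φ x) • gradient u x with hA
  set D := fun x => u x ^ t • gradient φ x with hD
  have hAcont : Continuous A := ((hup _).mul hφ.continuous).smul hgu.continuous
  have hDcont : Continuous D := (hup _).smul hgφ.continuous
  have hAcs : HasCompactSupport A := by
    refine hφc.mono fun x hx (h0 : φ x = 0) => hx (by simp [h0, hA])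
  have hDcs : HasCompactSupport D := by
    refine (hφc.fderiv ℝ).mono fun x hx (h0 : fderiv ℝ φ x = 0) => hx ?_
    have h : gradient φ x = 0 := by
      rw [← norm_eq_zero, norm_gradient_eq_norm_fderiv, h0, norm_zero]
    simp [hD, h]
  have ia : Integrable fun x => ω₁ x * ‖A x‖ ^ 2 := by
    refine (hω₁.continuous.mul (hAcont.norm.pow 2)).integrable_of_hasCompactSupport
      (hAcs.mono fun x hx (h0 : A x = 0) => hx (by simp [h0]))
  have ic : Integrable fun x => ω₁ x * ⟪A x, D x⟫ := by
    refine (hω₁.continuous.mul (hAcont.inner hDcont)).integrable_of_hasCompactSupport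
      (hAcs.mono fun x hx (h0 : A x = 0) => hx (by simp [h0]))
  have id : Integrable fun x => ω₁ x * ‖D x‖ ^ 2 := by
    refine (hω₁.continuous.mul (hDcont.norm.pow 2)).integrable_of_hasCompactSupport
      (hDcs.mono fun x hx (h0 : D x = 0) => hx (by simp [h0]))
  have hpt : ∫ x, k * (ω₁ x * ⟪A x, D x⟫) ≤ ∫ x, (σ * κ * (ω₁ x * ‖A x‖ ^ 2) +
      k ^ 2 / (4 * (σ * κ)) * (ω₁ x * ‖D x‖ ^ 2)) := by
    refine integral_mono (ic.const_mul _) ((ia.const_mul _).add (id.const_mul _)) fun x => ?_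
    have hσκ : 0 < σ * κ := mul_pos hσ0 hκ0
    have hcs := abs_real_inner_le_norm (A x) (D x)
    have h3 : k * ⟪A x, D x⟫ ≤ |k| * (‖A x‖ * ‖D x‖) :=
      (le_abs_self _).trans (by rw [abs_mul]; gcongr)
    have h4 : |k| * (‖A x‖ * ‖D x‖) ≤ σ * κ * ‖A x‖ ^ 2 + k ^ 2 / (4 * (σ * κ)) * ‖D x‖ ^ 2 := by
      have h5 : σ * κ * ‖A x‖ ^ 2 + k ^ 2 / (4 * (σ * κ)) * ‖D x‖ ^ 2 -
          |k| * (‖A x‖ * ‖D x‖) = (2 * (σ * κ) * ‖A x‖ - |k| * ‖D x‖) ^ 2 / (4 * (σ * κ)) := by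
        rw [← sq_abs k]
        field_simp
        ring
      have h6 : 0 ≤ (2 * (σ * κ) * ‖A x‖ - |k| * ‖D x‖) ^ 2 / (4 * (σ * κ)) := by positivity
      linarith
    have h7 := mul_le_mul_of_nonneg_left (h3.trans h4) (hω₁pos x).le
    simp only
    linarith
  rw [integral_add (ia.const_mul _) (ic.const_mul _), integral_const_mul, integral_const_mul] at h1
  have iac : Integrable fun x => t ^ 2 * (ω₁ x * ‖A x‖ ^ 2) + 2 * t * (ω₁ x * ⟪A x, D x⟫) :=
    (ia.const_mul _).add (ic.const_mul _)
  rw [integral_add iac id,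
    integral_add (ia.const_mul _) (ic.const_mul _), integral_const_mul, integral_const_mul] at h2
  rw [integral_add (ia.const_mul _) (id.const_mul _), integral_const_mul, integral_const_mul,
    integral_const_mul] at hpt
  have h8 := mul_le_mul_of_nonneg_left h2 hσ0.le
  have h9 := mul_le_mul_of_nonneg_left h1 (show 0 ≤ t ^ 2 + κ by positivity)
  rw [div_mul_eq_mul_div, le_div_iff₀ hκ0]
  have hpσ : p * σ = t ^ 2 + 2 * κ := by rw [hκ]; ring
  set B := ∫ x, ω₂ x * u x ^ (2 * t + p - 1) * φ x ^ 2
  set Ia := ∫ x, ω₁ x * ‖A x‖ ^ 2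
  set Ic := ∫ x, ω₁ x * ⟪A x, D x⟫
  set Id := ∫ x, ω₁ x * ‖D x‖ ^ 2
  have e1 : σ * (p * B) = (t ^ 2 + 2 * κ) * B := by rw [← hpσ]; ring
  rw [e1] at h8
  have e2 : M * Id = σ * Id + k ^ 2 / (4 * (σ * κ)) * Id := by rw [hM]; ring
  have e3 : k * Ic = 2 * t * σ * Ic - 2 * (t ^ 2 + κ) * Ic := by rw [hk]; ring
  rw [e2]
  rw [e3] at hpt
  linarith

end StableSubsolution

theorem exists_young_const {q s : ℝ} (hqs : q.HolderConjugate s) {ε : ℝ} (hε : 0 < ε) :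
    ∃ C : ℝ, 0 < C ∧ ∀ x y : ℝ, 0 ≤ x → 0 ≤ y → x * y ≤ ε * x ^ q + C * y ^ s := by
  have hq := hqs.pos
  have hs := hqs.symm.pos
  set δ := ε ^ (1 / q) with hδ
  have hδ0 : 0 < δ := rpow_pos_of_pos hε _
  refine ⟨δ⁻¹ ^ s / s, by positivity, fun x y hx hy => ?_⟩
  have h := young_inequality_of_nonneg (mul_nonneg hδ0.le hx) (mul_nonneg (inv_pos.2 hδ0).le hy) hqs
  rw [mul_rpow hδ0.le hx, mul_rpow (inv_pos.2 hδ0).le hy, hδ, ← rpow_mul hε.le,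
    one_div_mul_cancel hq.ne', rpow_one, ← hδ] at h
  have h2 : ε * x ^ q / q ≤ ε * x ^ q :=
    div_le_self (by positivity) hqs.lt.le
  have e : δ * x * (δ⁻¹ * y) = x * y := by field_simp
  rw [e] at h
  calc x * y ≤ _ := h
    _ ≤ _ := by rw [div_mul_eq_mul_div]; gcongr

theorem exists_weighted_young_const {p t ε : ℝ} (hp : 1 < p) (ht : 0 < t) (hε : 0 < ε) {m : ℕ}
    (hm : (2 * t + p - 1) / (p - 1) ≤ m) :
    ∃ C : ℝ, 0 < C ∧ ∀ w₁ w₂ u η g : ℝ, 0 < w₁ → 0 < w₂ → 0 < u → 0 ≤ η → η ≤ 1 → 0 ≤ g →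
      w₁ * (u ^ t * (η ^ (m - 1) * g)) ^ 2 ≤ ε * (w₂ * u ^ (2 * t + p - 1) * (η ^ m) ^ 2) +
        C * ((w₁ ^ (p + 2 * t - 1) / w₂ ^ (2 * t)) ^ (1 / (p - 1)) *
          (g ^ 2) ^ ((2 * t + p - 1) / (p - 1))) := by
  have hp1 : 0 < p - 1 := by linarith
  have hr : 0 < 2 * t + p - 1 := by linarith
  set q := (2 * t + p - 1) / (2 * t) with hq
  set s := (2 * t + p - 1) / (p - 1) with hs
  have hq0 : 0 < q := by positivity
  have hs0 : 0 < s := by positivity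
  have hq1 : 1 < q := by rw [hq, lt_div_iff₀ (by positivity)]; linarith
  have hs1 : 1 < s := by rw [hs, lt_div_iff₀ (by positivity)]; linarith
  have hqs : q.HolderConjugate s := by
    rw [Real.holderConjugate_iff]
    refine ⟨hq1, ?_⟩
    rw [hq, hs]
    field_simp
    ring
  have hm1 : 1 < m := by exact_mod_cast hs1.trans_le hm
  obtain ⟨C, hC, hY⟩ := exists_young_const hqs hε
  refine ⟨C, hC, fun w₁ w₂ u η g hw₁ hw₂ hu hη0 hη1 hg => ?_⟩
  have hur : 0 < u ^ (2 * t + p - 1) := rpow_pos_of_pos hu _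
  have h := hY ((w₂ * u ^ (2 * t + p - 1)) ^ (1 / q) * η ^ (2 * (m - 1)))
    (w₁ * w₂ ^ (-(1 / q)) * g ^ 2) (by positivity) (by positivity)
  have e1 : (w₂ * u ^ (2 * t + p - 1)) ^ (1 / q) = w₂ ^ (1 / q) * (u ^ t) ^ 2 := by
    rw [mul_rpow hw₂.le hur.le, ← rpow_mul hu.le, ← rpow_natCast (u ^ t), ← rpow_mul hu.le]
    congr 2
    rw [hq]
    push_cast
    field_simp
  have e2 : w₂ ^ (1 / q) * w₂ ^ (-(1 / q)) = 1 := by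
    rw [← rpow_add hw₂, add_neg_cancel, rpow_zero]
  have e3 : (w₂ * u ^ (2 * t + p - 1)) ^ (1 / q) * η ^ (2 * (m - 1)) *
      (w₁ * w₂ ^ (-(1 / q)) * g ^ 2) = w₁ * (u ^ t * (η ^ (m - 1) * g)) ^ 2 := by
    rw [e1, mul_comm 2 (m - 1), pow_mul]
    linear_combination (w₁ * (u ^ t) ^ 2 * (η ^ (m - 1)) ^ 2 * g ^ 2) * e2
  have e4 : ((w₂ * u ^ (2 * t + p - 1)) ^ (1 / q) * η ^ (2 * (m - 1))) ^ q ≤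
      w₂ * u ^ (2 * t + p - 1) * (η ^ m) ^ 2 := by
    rw [mul_rpow (by positivity) (by positivity), ← rpow_mul (by positivity),
      one_div_mul_cancel hq0.ne', rpow_one]
    gcongr
    rw [← pow_mul, ← rpow_natCast η, ← rpow_natCast η, ← rpow_mul hη0]
    refine rpow_le_rpow_of_exponent_ge_of_imp hη0 hη1 ?_ ?_
    · push_cast [Nat.cast_sub hm1.le]
      have h1 : s * (q - 1) = q := by rw [hs, hq]; field_simp; ring
      nlinarith [mul_le_mul_of_nonneg_right hm (sub_pos.2 hq1).le]
    · intro _ hz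
      have : 2 * (m - 1) = 0 := by exact_mod_cast (mul_eq_zero.1 hz).resolve_right hq0.ne'
      omega
  have e5 : (w₁ * w₂ ^ (-(1 / q)) * g ^ 2) ^ s =
      (w₁ ^ (p + 2 * t - 1) / w₂ ^ (2 * t)) ^ (1 / (p - 1)) * (g ^ 2) ^ s := by
    rw [mul_rpow (by positivity) (by positivity), mul_rpow (by positivity) (by positivity),
      ← rpow_mul hw₂.le, div_rpow (by positivity) (by positivity), ← rpow_mul hw₁.le,
      ← rpow_mul hw₂.le, div_eq_mul_inv (w₁ ^ _), ← rpow_neg hw₂.le]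
    congr 3
    · rw [hs]; ring
    · rw [hs, hq]; field_simp
  rw [e3, e5] at h
  exact h.trans (by gcongr)

theorem setIntegral_pos_of_continuous_of_pos {N : ℕ} {f : EuclideanSpace ℝ (Fin N) → ℝ}
    (hf : Continuous f) (hpos : ∀ x, 0 < f x) : 0 < ∫ x in Metric.closedBall 0 1, f x := by
  rw [setIntegral_pos_iff_support_of_nonneg_ae (Eventually.of_forall fun x => (hpos x).le)
    (hf.continuousOn.integrableOn_compact (isCompact_closedBall _ _)),
    Function.support_eq_univ fun x => (hpos x).ne', Set.univ_inter]
  exact Metric.measure_closedBall_pos _ _ one_pos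

theorem stmt_6 (N : ℕ) (hN : 1 ≤ N) (p : ℝ) (hp : 1 < p)
    (ω₁ ω₂ : EuclideanSpace ℝ (Fin N) → ℝ)
    (hω₁ : ContDiff ℝ (⊤ : ℕ∞) ω₁) (hω₂ : ContDiff ℝ (⊤ : ℕ∞) ω₂)
    (hω₁pos : ∀ x, 0 < ω₁ x) (hω₂pos : ∀ x, 0 < ω₂ x)
    (hmono : ∃ R₀ : ℝ, ∀ x : EuclideanSpace ℝ (Fin N), R₀ ≤ ‖x‖ → 0 ≤ ⟪gradient ω₁ x, x⟫)
    (t : ℝ) (ht1 : p - Real.sqrt (p * (p - 1)) < t) (ht2 : t ≤ 1)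
    (hIL : Tendsto (fun R : ℝ =>
      R ^ (-2*(2*t + p - 1)/(p - 1)) *
        ∫ x in annulus N R, (ω₁ x ^ (p + 2*t - 1) / ω₂ x ^ (2*t)) ^ (1/(p - 1)))
      atTop (nhds 0)) :
    ¬ ∃ u : EuclideanSpace ℝ (Fin N) → ℝ, ContDiff ℝ 2 u ∧ (∀ x, 0 < u x) ∧
      (∀ x, -vdiv (fun y => ω₁ y • gradient u y) x ≤ ω₂ x * u x ^ p) ∧
      (∀ ψ : EuclideanSpace ℝ (Fin N) → ℝ, ContDiff ℝ 2 ψ → HasCompactSupport ψ →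
        ∫ x, p * ω₂ x * u x ^ (p - 1) * ψ x ^ 2 ≤ ∫ x, ω₁ x * ‖gradient ψ x‖ ^ 2) := by
  rintro ⟨u, hu, hupos, hsub, hstab⟩
  have hpt : t ^ 2 < p * (2 * t - 1) := by
    have h1 : (p - t) ^ 2 < p * (p - 1) := by
      rw [← Real.lt_sqrt (by linarith)]
      linarith
    nlinarith
  have ht : 1 < 2 * t := by nlinarith [sq_nonneg t]
  have hω₁c := hω₁.continuous
  have hω₂c := hω₂.continuous
  obtain ⟨K, hK, hcac⟩ := exists_caccioppoli_const (hω₁.of_le (by exact_mod_cast le_top)) hω₂c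
    hω₁pos hu hupos hsub hstab ht hpt
  obtain ⟨C, hC, hcut⟩ := exists_cutoff (EuclideanSpace ℝ (Fin N))
  set s := (2 * t + p - 1) / (p - 1) with hs
  obtain ⟨m, hm⟩ := exists_nat_ge s
  obtain ⟨Y, hY, hyoung⟩ := exists_weighted_young_const hp (by linarith : 0 < t)
    (ε := 1 / (2 * K)) (by positivity) hm
  set W := fun x => (ω₁ x ^ (p + 2 * t - 1) / ω₂ x ^ (2 * t)) ^ (1 / (p - 1)) with hW
  have hW0 : ∀ x, 0 ≤ W x := fun x =>
    rpow_nonneg (div_nonneg (rpow_nonneg (hω₁pos x).le _) (rpow_nonneg (hω₂pos x).le _)) _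
  have hWc : Continuous W := by
    refine ((hω₁c.rpow_const fun x => Or.inl (hω₁pos x).ne').div
      (hω₂c.rpow_const fun x => Or.inl (hω₂pos x).ne')
      fun x => (rpow_pos_of_pos (hω₂pos x) _).ne').rpow_const fun x => Or.inl ?_
    exact (div_pos (rpow_pos_of_pos (hω₁pos x) _) (rpow_pos_of_pos (hω₂pos x) _)).ne'
  have hupc : ∀ r : ℝ, Continuous fun x => u x ^ r := fun r =>
    hu.continuous.rpow_const fun x => Or.inl (hupos x).ne'
  have hbc : Continuous fun x => ω₂ x * u x ^ (2 * t + p - 1) := hω₂c.mul (hupc _)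
  have hb0 : ∀ x, 0 < ω₂ x * u x ^ (2 * t + p - 1) := fun x =>
    mul_pos (hω₂pos x) (rpow_pos_of_pos (hupos x) _)
  set β := ∫ x in Metric.closedBall 0 1, ω₂ x * u x ^ (2 * t + p - 1) with hβ
  have hβ0 : 0 < β := setIntegral_pos_of_continuous_of_pos hbc hb0
  set L := 2 * K * Y * ((m * C) ^ 2) ^ s with hL
  have key : ∀ R : ℝ, 1 ≤ R →
      β ≤ L * (R ^ (-2*(2*t + p - 1)/(p - 1)) * ∫ x in annulus N R, W x) := by
    intro R hR
    have hR0 : 0 < R := by linarith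
    obtain ⟨η, hη, hηc, hη0, hη1, hηone, hηgrad, hηann⟩ := hcut R hR0
    have hm0 : m ≠ 0 := by
      rintro rfl
      have : 0 < s := div_pos (by linarith) (by linarith)
      simp at hm
      linarith
    have hφ : ContDiff ℝ 2 fun x => η x ^ m := hη.pow m
    have hφc : HasCompactSupport fun x => η x ^ m :=
      hηc.mono fun x hx (h0 : η x = 0) => hx (by simp [h0, hm0])
    have hgrad : ∀ x, gradient (fun y => η y ^ m) x = (m * η x ^ (m - 1)) • gradient η x :=
      fun x => ((hη.differentiable two_ne_zero x).hasGradientAt.pow m).gradient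
    have hann : MeasurableSet (annulus N R) :=
      ((isOpen_lt continuous_const continuous_norm).inter
        (isOpen_lt continuous_norm continuous_const)).measurableSet
    have hWi : IntegrableOn W (annulus N R) :=
      (hWc.continuousOn.integrableOn_compact (isCompact_closedBall 0 (2 * R))).mono_set
        fun x hx => by simpa using hx.2.le
    have hbi : Integrable fun x => ω₂ x * u x ^ (2 * t + p - 1) * (η x ^ m) ^ 2 :=
      (hbc.mul (hφ.continuous.pow 2)).integrable_of_hasCompactSupport
        (hφc.mono fun x hx (h0 : η x ^ m = 0) => hx (by simp [h0]))
    have hIi : Integrable ((annulus N R).indicator W) := hWi.integrable_indicator hann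
    have hle : ∫ x, ω₁ x * ‖u x ^ t • gradient (fun y => η y ^ m) x‖ ^ 2 ≤
        ∫ x, (1 / (2 * K) * (ω₂ x * u x ^ (2 * t + p - 1) * (η x ^ m) ^ 2) +
          Y * (((m * C / R) ^ 2) ^ s) * (annulus N R).indicator W x) := by
      refine integral_mono_of_nonneg (Eventually.of_forall fun x => ?_)
        ((hbi.const_mul _).add (hIi.const_mul _)) (Eventually.of_forall fun x => ?_)
      · exact mul_nonneg (hω₁pos x).le (sq_nonneg _)
      · simp only
        rw [hgrad]
        by_cases hx : x ∈ annulus N R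
        · rw [Set.indicator_of_mem hx]
          refine le_trans ?_ ((hyoung (ω₁ x) (ω₂ x) (u x) (η x) (m * C / R) (hω₁pos x) (hω₂pos x)
            (hupos x) (hη0 x) (hη1 x) (by positivity)).trans_eq (by ring))
          rw [norm_smul, norm_smul, Real.norm_of_nonneg (rpow_nonneg (hupos x).le t),
            Real.norm_of_nonneg (mul_nonneg m.cast_nonneg (pow_nonneg (hη0 x) _))]
          have h1 := hω₁pos x
          have h2 := hη0 x
          have h3 := (rpow_pos_of_pos (hupos x) t).le
          have h4 := hηgrad x
          have e : m * η x ^ (m - 1) * ‖gradient η x‖ ≤ η x ^ (m - 1) * (m * C / R) := by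
            calc m * η x ^ (m - 1) * ‖gradient η x‖ ≤ m * η x ^ (m - 1) * (C / R) := by gcongr
              _ = η x ^ (m - 1) * (m * C / R) := by ring
          gcongr
        · rw [Set.indicator_of_notMem hx, hηann x hx]
          have := hb0 x
          simp only [smul_zero, norm_zero, zero_pow two_ne_zero, mul_zero, add_zero]
          positivity
    rw [integral_add (hbi.const_mul _) (hIi.const_mul _), integral_const_mul, integral_const_mul,
      integral_indicator hann] at hle
    have h1 := (hcac _ hφ hφc).trans (mul_le_mul_of_nonneg_left hle hK.le)
    have h2 : β ≤ ∫ x, ω₂ x * u x ^ (2 * t + p - 1) * (η x ^ m) ^ 2 := by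
      have : β = ∫ x in Metric.closedBall 0 1, ω₂ x * u x ^ (2 * t + p - 1) * (η x ^ m) ^ 2 := by
        refine setIntegral_congr_fun Metric.isClosed_closedBall.measurableSet fun x hx => ?_
        have : ‖x‖ ≤ R := by
          have : ‖x‖ ≤ 1 := by simpa using hx
          linarith
        simp [hηone x this]
      rw [this]
      exact setIntegral_le_integral hbi
        (Eventually.of_forall fun x => mul_nonneg (hb0 x).le (sq_nonneg _))
    have h3 : ((m * C / R) ^ 2) ^ s = ((m * C) ^ 2) ^ s * R ^ (-2*(2*t + p - 1)/(p - 1)) := by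
      rw [div_pow, div_rpow (by positivity) (by positivity), div_eq_mul_inv, ← rpow_natCast R,
        ← rpow_mul hR0.le, ← rpow_neg hR0.le]
      congr 2
      rw [hs]
      push_cast
      ring
    rw [h3] at h1
    set B := ∫ x, ω₂ x * u x ^ (2 * t + p - 1) * (η x ^ m) ^ 2
    have h4 : K * (1 / (2 * K) * B) = B / 2 := by field_simp
    rw [mul_add, h4] at h1
    rw [hL]
    linarith
  have hlim := hIL.const_mul L
  rw [mul_zero] at hlim
  exact absurd (ge_of_tendsto hlim ((eventually_ge_atTop 1).mono key)) (not_le.2 hβ0)
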